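/- Assume condition (i) only (no assumption on second commutators), and assume Ω has C¹ boundary. Define the vector fields Y_j := Σ_{i=1}^m [X_i,[X_i,X_j]] for j = 1,…,m, and set 𝓕_2*[u] := 𝓕_2[u] + ½ Σ_{j=1}^m X_ju · Y_ju. Let u, v ∈ C²(closure of Ω) (for 𝓕_2* use u,v ∈ C³) satisfy u ≤ v in Ω, u = v on ∂Ω, and suppose the symmetric matrix [(Δ_X(u+v))δ_{ij} − (X_s²(u+v))_{ij}] is positive semidefinite in Ω. Then ∫_Ω 𝓕_2*[v] ≤ ∫_Ω 𝓕_2*[u]. -/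

import Mathlib

open MeasureTheory Filter Topology

noncomputable section

/-- Action of a first-order vector field with coefficient vector `c` on a function `u`:
`(Xu)(x) = ∑ j c(x)_j D_j u(x) = Du(x)·c(x)`. -/
def Xop {n : ℕ} (c : (Fin n → ℝ) → (Fin n → ℝ)) (u : (Fin n → ℝ) → ℝ)
    (x : Fin n → ℝ) : ℝ :=
  fderiv ℝ u x (c x)

/-- Lie bracket of the coefficient vector fields `c`, `d`. -/
def vfBracket {n : ℕ} (c d : (Fin n → ℝ) → (Fin n → ℝ)) (x : Fin n → ℝ) :
    Fin n → ℝ :=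
  fun l => fderiv ℝ (fun y => d y l) x (c x) - fderiv ℝ (fun y => c y l) x (d x)

/-- The sub-Laplacian `Δ_X u = ∑ i X_i X_i u`. -/
def subLap {n m : ℕ} (b : Fin m → (Fin n → ℝ) → (Fin n → ℝ))
    (u : (Fin n → ℝ) → ℝ) (x : Fin n → ℝ) : ℝ :=
  ∑ i, Xop (b i) (Xop (b i) u) x

/-- The commutator `[X_i, X_j] u = X_i X_j u - X_j X_i u`. -/
def commOp {n m : ℕ} (b : Fin m → (Fin n → ℝ) → (Fin n → ℝ)) (i j : Fin m)
    (u : (Fin n → ℝ) → ℝ) (x : Fin n → ℝ) : ℝ :=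
  Xop (b i) (Xop (b j) u) x - Xop (b j) (Xop (b i) u) x

/-- The symmetric Hessian `X_s² u = [½ (X_i X_j + X_j X_i) u]`. -/
def symmHess {n m : ℕ} (b : Fin m → (Fin n → ℝ) → (Fin n → ℝ))
    (u : (Fin n → ℝ) → ℝ) (x : Fin n → ℝ) : Matrix (Fin m) (Fin m) ℝ :=
  fun i j => (Xop (b i) (Xop (b j) u) x + Xop (b j) (Xop (b i) u) x) / 2

theorem symmHess_isHermitian {n m : ℕ} (b : Fin m → (Fin n → ℝ) → (Fin n → ℝ))
    (u : (Fin n → ℝ) → ℝ) (x : Fin n → ℝ) : (symmHess b u x).IsHermitian := by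
  unfold Matrix.IsHermitian
  ext i j
  simp only [Matrix.conjTranspose_apply, symmHess, star_trivial]
  ring

/-- Eigenvalues of the symmetric Hessian. -/
def hessEig {n m : ℕ} (b : Fin m → (Fin n → ℝ) → (Fin n → ℝ))
    (u : (Fin n → ℝ) → ℝ) (x : Fin n → ℝ) : Fin m → ℝ :=
  (symmHess_isHermitian b u x).eigenvalues

/-- `k`-th elementary symmetric function of `m` real numbers. -/
def esymmF {m : ℕ} (k : ℕ) (lam : Fin m → ℝ) : ℝ :=
  ∑ s ∈ Finset.powersetCard k (Finset.univ : Finset (Fin m)), ∏ i ∈ s, lam i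

/-- `S_{j,i}(λ)`: the `j`-th elementary symmetric function with the variable `λ_i` set to `0`. -/
def esymmDrop {m : ℕ} (j : ℕ) (i : Fin m) (lam : Fin m → ℝ) : ℝ :=
  ∑ s ∈ Finset.powersetCard j ((Finset.univ : Finset (Fin m)).erase i), ∏ l ∈ s, lam l

/-- `u` is `k`-convex with respect to the vector fields `b` on `Ω`:
`S_j(λ(X_s²u)) ≥ 0` on `Ω` for `j = 1, …, k`. -/
def IsKConvex {n m : ℕ} (Ω : Set (Fin n → ℝ)) (b : Fin m → (Fin n → ℝ) → (Fin n → ℝ))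
    (k : ℕ) (u : (Fin n → ℝ) → ℝ) : Prop :=
  ∀ x ∈ Ω, ∀ j, 1 ≤ j → j ≤ k → 0 ≤ esymmF j (hessEig b u x)

/-- `F_2[u] = S_2(λ(X_s²u))`. -/
def F2fun {n m : ℕ} (b : Fin m → (Fin n → ℝ) → (Fin n → ℝ))
    (u : (Fin n → ℝ) → ℝ) (x : Fin n → ℝ) : ℝ :=
  esymmF 2 (hessEig b u x)

/-- `𝓔_2[u] = ∑_{i<j} ([X_i,X_j]u)²`. -/
def E2fun {n m : ℕ} (b : Fin m → (Fin n → ℝ) → (Fin n → ℝ))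
    (u : (Fin n → ℝ) → ℝ) (x : Fin n → ℝ) : ℝ :=
  ∑ i : Fin m, ∑ j ∈ Finset.Ioi i, (commOp b i j u x) ^ 2

/-- `𝓕_2[u] = F_2[u] + (3/4) 𝓔_2[u]`. -/
def calF2 {n m : ℕ} (b : Fin m → (Fin n → ℝ) → (Fin n → ℝ))
    (u : (Fin n → ℝ) → ℝ) (x : Fin n → ℝ) : ℝ :=
  F2fun b u x + (3 / 4) * E2fun b u x

/-- `|Xu|(x)`, the length of the subelliptic gradient. -/
def XgradNorm {n m : ℕ} (b : Fin m → (Fin n → ℝ) → (Fin n → ℝ))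
    (u : (Fin n → ℝ) → ℝ) (x : Fin n → ℝ) : ℝ :=
  Real.sqrt (∑ i, (Xop (b i) u x) ^ 2)

/-- Condition (i): each `X_i` is divergence free, i.e. anti-self-adjoint. -/
def DivFree {n m : ℕ} (Ω : Set (Fin n → ℝ))
    (b : Fin m → (Fin n → ℝ) → (Fin n → ℝ)) : Prop :=
  ∀ i : Fin m, ∀ x ∈ Ω, ∑ j, fderiv ℝ (fun y => b i y j) x (Pi.single j 1) = 0

/-- The set of iterated Lie brackets generated by the fields `b`. -/
inductive LieGen {n m : ℕ} (b : Fin m → (Fin n → ℝ) → (Fin n → ℝ)) :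
    ((Fin n → ℝ) → (Fin n → ℝ)) → Prop
  | base (i : Fin m) : LieGen b (b i)
  | bracket {c d : (Fin n → ℝ) → (Fin n → ℝ)} :
      LieGen b c → LieGen b d → LieGen b (fun x => vfBracket c d x)

/-- Condition (ii): the Hörmander condition; iterated commutators span `ℝⁿ` at each point. -/
def Hormander {n m : ℕ} (Ω : Set (Fin n → ℝ))
    (b : Fin m → (Fin n → ℝ) → (Fin n → ℝ)) : Prop :=
  ∀ x ∈ Ω, Submodule.span ℝ {v : Fin n → ℝ | ∃ c, LieGen b c ∧ c x = v} = ⊤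

/-- Condition (iii): all second commutators `[X_i,[X_i,X_j]]` vanish. -/
def SecondCommVanish {n m : ℕ} (Ω : Set (Fin n → ℝ))
    (b : Fin m → (Fin n → ℝ) → (Fin n → ℝ)) : Prop :=
  ∀ i j : Fin m, ∀ x ∈ Ω, vfBracket (b i) (fun y => vfBracket (b i) (b j) y) x = 0

/-- `Ω' ⊂⊂ Ω`: `Ω'` is open and compactly contained in `Ω`. -/
def CptIn {n : ℕ} (Ω' Ω : Set (Fin n → ℝ)) : Prop :=
  IsOpen Ω' ∧ IsCompact (closure Ω') ∧ closure Ω' ⊆ Ω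

/-- A sub-unitary (piecewise C¹) curve on `[0,T]` with respect to the fields `b`. -/
def IsSubunitary {n m : ℕ} (b : Fin m → (Fin n → ℝ) → (Fin n → ℝ)) (T : ℝ)
    (γ : ℝ → Fin n → ℝ) : Prop :=
  ContinuousOn γ (Set.Icc 0 T) ∧
  ∃ S : Finset ℝ, ∀ t ∈ Set.Ioo 0 T, t ∉ S →
    ∃ γ' : Fin n → ℝ, HasDerivAt γ γ' t ∧
      ∀ ξ : Fin n → ℝ, (∑ j, γ' j * ξ j) ^ 2 ≤ ∑ i, (∑ j, b i (γ t) j * ξ j) ^ 2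

/-- The Carnot–Carathéodory distance associated with the fields `b`. -/
def ccDist {n m : ℕ} (b : Fin m → (Fin n → ℝ) → (Fin n → ℝ))
    (x y : Fin n → ℝ) : ℝ :=
  sInf {T : ℝ | 0 < T ∧ ∃ γ : ℝ → Fin n → ℝ,
    IsSubunitary b T γ ∧ γ 0 = x ∧ γ T = y}

/-- The C-C ball of radius `R` about `x`. -/
def ccBall {n m : ℕ} (b : Fin m → (Fin n → ℝ) → (Fin n → ℝ))
    (x : Fin n → ℝ) (R : ℝ) : Set (Fin n → ℝ) :=
  {y | ccDist b x y < R}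

/-- The doubling property `|B_{tR}(x)| ≥ C t^Q |B_R(x)|`. -/
def DoublingDim {n m : ℕ} (Ω : Set (Fin n → ℝ))
    (b : Fin m → (Fin n → ℝ) → (Fin n → ℝ)) (Q : ℕ) : Prop :=
  ∃ C > (0 : ℝ), ∃ R0 > (0 : ℝ), ∀ x ∈ Ω, ∀ t ∈ Set.Ioo (0 : ℝ) 1,
    ∀ R : ℝ, 0 < R → R < R0 →
      C * t ^ Q * (volume (ccBall b x R)).toReal ≤ (volume (ccBall b x (t * R))).toReal

/-- `Q` is the homogeneous dimension of the system `b` in `Ω`. -/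
def IsHomDim {n m : ℕ} (Ω : Set (Fin n → ℝ))
    (b : Fin m → (Fin n → ℝ) → (Fin n → ℝ)) (Q : ℕ) : Prop :=
  0 < Q ∧ DoublingDim Ω b Q ∧ ∀ Q' : ℕ, 0 < Q' → DoublingDim Ω b Q' → Q ≤ Q'

/-- The class `φ^k(Ω)` of `L¹_loc(Ω)` limits of smooth `k`-convex functions. -/
def PhiK {n m : ℕ} (Ω : Set (Fin n → ℝ)) (b : Fin m → (Fin n → ℝ) → (Fin n → ℝ))
    (k : ℕ) (u : (Fin n → ℝ) → ℝ) : Prop :=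
  LocallyIntegrableOn u Ω ∧
  ∀ Ω' : Set (Fin n → ℝ), CptIn Ω' Ω →
    ∃ us : ℕ → (Fin n → ℝ) → ℝ,
      (∀ l, ContDiffOn ℝ 2 (us l) Ω' ∧ IsKConvex Ω' b k (us l)) ∧
      ∀ K : Set (Fin n → ℝ), K ⊆ Ω' → IsCompact K →
        Tendsto (fun l => ∫ x in K, |us l x - u x|) atTop (𝓝 0)

end

/-- `Ω` has `C¹` boundary: near each boundary point, `Ω` is the sublevel set of a
`C¹` function with nonvanishing gradient. -/
def HasC1Boundary {n : ℕ} (Ω : Set (Fin n → ℝ)) : Prop :=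
  ∀ x ∈ frontier Ω, ∃ U : Set (Fin n → ℝ), IsOpen U ∧ x ∈ U ∧
    ∃ f : (Fin n → ℝ) → ℝ, ContDiff ℝ 1 f ∧ (∀ y ∈ U, fderiv ℝ f y ≠ 0) ∧
      Ω ∩ U = {y ∈ U | f y < 0}

/-- `Y_j u = ∑_i [X_i,[X_i,X_j]] u = ∑_i (X_iX_iX_j - 2 X_iX_jX_i + X_jX_iX_i) u`. -/
noncomputable def Yop {n m : ℕ} (b : Fin m → (Fin n → ℝ) → (Fin n → ℝ)) (j : Fin m)
    (u : (Fin n → ℝ) → ℝ) (x : Fin n → ℝ) : ℝ :=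
  ∑ i : Fin m,
    (Xop (b i) (Xop (b i) (Xop (b j) u)) x -
      2 * Xop (b i) (Xop (b j) (Xop (b i) u)) x +
      Xop (b j) (Xop (b i) (Xop (b i) u)) x)

/-- `𝓕₂*[u] = 𝓕₂[u] + ½ ∑_j X_j u · Y_j u`. -/
noncomputable def calF2star {n m : ℕ} (b : Fin m → (Fin n → ℝ) → (Fin n → ℝ))
    (u : (Fin n → ℝ) → ℝ) (x : Fin n → ℝ) : ℝ :=
  calF2 b u x + (1 / 2) * ∑ j : Fin m, Xop (b j) u x * Yop b j u x

theorem two_mul_esymmF_two {m : ℕ} (lam : Fin m → ℝ) :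
    2 * esymmF 2 lam = (∑ i, lam i) ^ 2 - ∑ i, lam i ^ 2 := by
  have h := congrArg (MvPolynomial.aeval lam) (MvPolynomial.mul_esymm_eq_sum (Fin m) ℝ 2)
  have hs : (Finset.HasAntidiagonal.antidiagonal (2 : ℕ)).filter (fun a => a.1 < 2)
      = ({(0, 2), (1, 1)} : Finset (ℕ × ℕ)) := by
    decide
  rw [hs, Finset.sum_pair (by decide)] at h
  simp only [MvPolynomial.esymm_zero, MvPolynomial.esymm_one, MvPolynomial.psum_one] at h
  simp only [MvPolynomial.esymm, MvPolynomial.psum, map_mul, map_add, map_sum, map_prod, map_pow,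
    map_neg, map_one, map_natCast, MvPolynomial.aeval_X] at h
  simp only [esymmF]
  push_cast at h
  rw [h]
  ring

theorem Matrix.IsHermitian.sum_eigenvalues_sq {m : ℕ} {A : Matrix (Fin m) (Fin m) ℝ}
    (hA : A.IsHermitian) : ∑ i, hA.eigenvalues i ^ 2 = ∑ i, ∑ j, A i j ^ 2 := by
  have h1 : (A * A).trace = ∑ i, hA.eigenvalues i ^ 2 := by
    conv_lhs => rw [hA.spectral_theorem, ← map_mul, Unitary.conjStarAlgAut_apply,
      Matrix.trace_mul_comm, ← mul_assoc]
    simp [Matrix.trace_diagonal, sq]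
  rw [← h1, Matrix.trace]
  refine Finset.sum_congr rfl fun i _ => ?_
  rw [Matrix.diag_apply, Matrix.mul_apply]
  refine Finset.sum_congr rfl fun j _ => ?_
  have : A j i = A i j := by simpa using hA.apply i j
  rw [this, sq]

/-- The bilinear form whose diagonal is `calF2star`. -/
noncomputable def calF2bil {n m : ℕ} (b : Fin m → (Fin n → ℝ) → (Fin n → ℝ))
    (f g : (Fin n → ℝ) → ℝ) (x : Fin n → ℝ) : ℝ :=
  ∑ i : Fin m, ∑ j : Fin m,
    ((1 / 4) * (Xop (b i) (Xop (b i) f) x * Xop (b j) (Xop (b j) g) x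
        + Xop (b j) (Xop (b j) f) x * Xop (b i) (Xop (b i) g) x)
      + (1 / 2) * (Xop (b i) (Xop (b j) f) x * Xop (b i) (Xop (b j) g) x)
      - (1 / 2) * (Xop (b i) (Xop (b j) f) x * Xop (b j) (Xop (b i) g) x
        + Xop (b j) (Xop (b i) f) x * Xop (b i) (Xop (b j) g) x)
      + (1 / 4) * (Xop (b j) f x *
        (Xop (b i) (Xop (b i) (Xop (b j) g)) x - 2 * Xop (b i) (Xop (b j) (Xop (b i) g)) x +
          Xop (b j) (Xop (b i) (Xop (b i) g)) x))
      + (1 / 4) * (Xop (b j) g x *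
        (Xop (b i) (Xop (b i) (Xop (b j) f)) x - 2 * Xop (b i) (Xop (b j) (Xop (b i) f)) x +
          Xop (b j) (Xop (b i) (Xop (b i) f)) x)))

theorem two_mul_E2fun {n m : ℕ} (b : Fin m → (Fin n → ℝ) → (Fin n → ℝ))
    (u : (Fin n → ℝ) → ℝ) (x : Fin n → ℝ) :
    2 * E2fun b u x = ∑ i, ∑ j, commOp b i j u x ^ 2 := by
  have h := Finset.sum_sum_Ioi_add_eq_sum_sum_off_diag
    (fun i j : Fin m => commOp b i j u x ^ 2)
  have hsymm : ∀ i j : Fin m, commOp b j i u x ^ 2 = commOp b i j u x ^ 2 := fun i j => by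
    simp only [commOp]; ring
  have hdiag : ∀ i : Fin m, ∑ j, commOp b i j u x ^ 2
      = ∑ j ∈ ({i}ᶜ : Finset (Fin m)), commOp b j i u x ^ 2 := fun i => by
    rw [← Finset.sum_compl_add_sum {i}, Finset.sum_singleton]
    simp only [hsymm]
    simp [commOp]
  rw [Finset.sum_congr rfl fun i _ => hdiag i, ← h, E2fun, Finset.mul_sum]
  refine Finset.sum_congr rfl fun i _ => ?_
  rw [Finset.mul_sum]
  refine Finset.sum_congr rfl fun j _ => ?_
  rw [hsymm j i]
  ring

theorem calF2star_eq_calF2bil {n m : ℕ} (b : Fin m → (Fin n → ℝ) → (Fin n → ℝ))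
    (u : (Fin n → ℝ) → ℝ) (x : Fin n → ℝ) : calF2star b u x = calF2bil b u u x := by
  have h1 := two_mul_esymmF_two (hessEig b u x)
  have h2 := (symmHess_isHermitian b u x).trace_eq_sum_eigenvalues
  have h3 := (symmHess_isHermitian b u x).sum_eigenvalues_sq
  have h4 := two_mul_E2fun b u x
  simp only [RCLike.ofReal_real_eq_id, id] at h2
  have hH : F2fun b u x = (1 / 2) * ((symmHess b u x).trace ^ 2 - ∑ i, ∑ j, symmHess b u x i j ^ 2) := by
    rw [h2, ← h3, F2fun]
    simp only [hessEig] at h1 ⊢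
    linarith
  have hE : E2fun b u x = (1 / 2) * ∑ i, ∑ j, commOp b i j u x ^ 2 := by linarith
  have hY : ∑ j, Xop (b j) u x * Yop b j u x = ∑ i, ∑ j, Xop (b j) u x *
        (Xop (b i) (Xop (b i) (Xop (b j) u)) x - 2 * Xop (b i) (Xop (b j) (Xop (b i) u)) x +
          Xop (b j) (Xop (b i) (Xop (b i) u)) x) := by
    simp only [Yop, Finset.mul_sum]
    rw [Finset.sum_comm]
  have hT : (symmHess b u x).trace ^ 2
      = ∑ i, ∑ j, Xop (b i) (Xop (b i) u) x * Xop (b j) (Xop (b j) u) x := by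
    simp only [Matrix.trace, Matrix.diag_apply, symmHess, add_self_div_two]
    rw [sq, Finset.sum_mul_sum]
  have hsw : ∑ i, ∑ j, Xop (b i) (Xop (b j) u) x ^ 2 = ∑ i, ∑ j, Xop (b j) (Xop (b i) u) x ^ 2 :=
    Finset.sum_comm
  have hHs : ∑ i, ∑ j, symmHess b u x i j ^ 2 = ∑ i, ∑ j,
      ((1 / 2) * Xop (b i) (Xop (b j) u) x ^ 2
        + (1 / 2) * (Xop (b i) (Xop (b j) u) x * Xop (b j) (Xop (b i) u) x)) := by
    have : ∀ i j, symmHess b u x i j ^ 2 = (1 / 4) * Xop (b i) (Xop (b j) u) x ^ 2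
        + (1 / 4) * Xop (b j) (Xop (b i) u) x ^ 2
        + (1 / 2) * (Xop (b i) (Xop (b j) u) x * Xop (b j) (Xop (b i) u) x) := fun i j => by
      simp only [symmHess]; ring
    simp only [this, Finset.sum_add_distrib, ← Finset.mul_sum]
    rw [← hsw]; ring
  have hC : ∑ i, ∑ j, commOp b i j u x ^ 2 = ∑ i, ∑ j, (2 * Xop (b i) (Xop (b j) u) x ^ 2
        - 2 * (Xop (b i) (Xop (b j) u) x * Xop (b j) (Xop (b i) u) x)) := by
    have : ∀ i j, commOp b i j u x ^ 2 = Xop (b i) (Xop (b j) u) x ^ 2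
        + Xop (b j) (Xop (b i) u) x ^ 2
        - 2 * (Xop (b i) (Xop (b j) u) x * Xop (b j) (Xop (b i) u) x) := fun i j => by
      simp only [commOp]; ring
    simp only [this, Finset.sum_add_distrib, Finset.sum_sub_distrib, ← Finset.mul_sum]
    rw [← hsw]; ring
  rw [calF2star, calF2, hH, hE, hY, hT, hHs, hC]
  simp only [calF2bil, Finset.mul_sum, ← Finset.sum_add_distrib, ← Finset.sum_sub_distrib]
  refine Finset.sum_congr rfl fun i _ => Finset.sum_congr rfl fun j _ => ?_
  ring

/-- `g` is on `Ω`, near every point of `closure Ω`, the restriction of a function that is `C^k`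
within `closure Ω` at that point. -/
def SmoothUpTo {n : ℕ} (Ω : Set (Fin n → ℝ)) (k : ℕ) (g : (Fin n → ℝ) → ℝ) : Prop :=
  ∀ x ∈ closure Ω, ∃ h : (Fin n → ℝ) → ℝ, ContDiffWithinAt ℝ k h (closure Ω) x ∧ g =ᶠ[𝓝[Ω] x] h

section Xop

variable {n : ℕ} {Ω : Set (Fin n → ℝ)} {c : (Fin n → ℝ) → (Fin n → ℝ)}
  {f g h : (Fin n → ℝ) → ℝ} {x : Fin n → ℝ}

theorem Xop_congr (hΩ : IsOpen Ω) (hfg : ∀ x ∈ Ω, f x = g x) : ∀ x ∈ Ω, Xop c f x = Xop c g x :=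
  fun x hx => by
    have : f =ᶠ[𝓝 x] g := Filter.eventually_of_mem (hΩ.mem_nhds hx) hfg
    simp only [Xop, this.fderiv_eq]

theorem Xop_eq_zero_of_eqOn_zero (hΩ : IsOpen Ω) (hf : ∀ x ∈ Ω, f x = 0) :
    ∀ x ∈ Ω, Xop c f x = 0 := fun x hx => by
  rw [Xop_congr (g := fun _ => 0) hΩ hf x hx]
  simp [Xop]

theorem Xop_add (hf : DifferentiableAt ℝ f x) (hg : DifferentiableAt ℝ g x) :
    Xop c (fun y => f y + g y) x = Xop c f x + Xop c g x := by
  simp only [Xop]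
  rw [fderiv_fun_add hf hg]
  rfl

theorem Xop_mul (hf : DifferentiableAt ℝ f x) (hg : DifferentiableAt ℝ g x) :
    Xop c (fun y => f y * g y) x = Xop c f x * g x + f x * Xop c g x := by
  simp only [Xop]
  rw [fderiv_fun_mul hf hg]
  simp only [add_apply, smul_apply, smul_eq_mul]
  ring

theorem Xop_const_mul (a : ℝ) (hf : DifferentiableAt ℝ f x) :
    Xop c (fun y => a * f y) x = a * Xop c f x := by
  rw [Xop_mul (differentiableAt_const a) hf]
  simp [Xop]

theorem Xop_comp {φ : ℝ → ℝ} (hφ : DifferentiableAt ℝ φ (f x)) (hf : DifferentiableAt ℝ f x) :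
    Xop c (fun y => φ (f y)) x = deriv φ (f x) * Xop c f x := by
  have := fderiv_comp x hφ hf
  simp only [Function.comp_def] at this
  simp only [Xop, this]
  simp [fderiv_eq_smul_deriv, mul_comm]

theorem Xop_linear (hΩ : IsOpen Ω) {α β : ℝ} (hf : DifferentiableOn ℝ f Ω)
    (hg : DifferentiableOn ℝ g Ω) (hh : ∀ x ∈ Ω, h x = α * f x + β * g x) :
    ∀ x ∈ Ω, Xop c h x = α * Xop c f x + β * Xop c g x := fun x hx => by
  have hf' := (hf x hx).differentiableAt (hΩ.mem_nhds hx)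
  have hg' := (hg x hx).differentiableAt (hΩ.mem_nhds hx)
  rw [Xop_congr hΩ hh x hx, Xop_add (hf'.const_mul α) (hg'.const_mul β), Xop_const_mul α hf',
    Xop_const_mul β hg']

end Xop

namespace SmoothUpTo

variable {n : ℕ} {Ω : Set (Fin n → ℝ)} {k : ℕ} {f g : (Fin n → ℝ) → ℝ}

theorem of_contDiffOn {N : WithTop ℕ∞} (hg : ContDiffOn ℝ N g (closure Ω)) (hk : (k : WithTop ℕ∞) ≤ N) :
    SmoothUpTo Ω k g :=
  fun x hx => ⟨g, (hg x hx).of_le hk, Filter.EventuallyEq.rfl⟩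

theorem of_le {l : ℕ} (hg : SmoothUpTo Ω k g) (hl : l ≤ k) : SmoothUpTo Ω l g := fun x hx => by
  obtain ⟨h, hh, hgh⟩ := hg x hx
  exact ⟨h, hh.of_le (by exact_mod_cast hl), hgh⟩

theorem add (hf : SmoothUpTo Ω k f) (hg : SmoothUpTo Ω k g) :
    SmoothUpTo Ω k (fun x => f x + g x) := fun x hx => by
  obtain ⟨p, hp, hfp⟩ := hf x hx
  obtain ⟨q, hq, hgq⟩ := hg x hx
  exact ⟨fun x => p x + q x, hp.add hq, hfp.add hgq⟩

theorem sub (hf : SmoothUpTo Ω k f) (hg : SmoothUpTo Ω k g) :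
    SmoothUpTo Ω k (fun x => f x - g x) := fun x hx => by
  obtain ⟨p, hp, hfp⟩ := hf x hx
  obtain ⟨q, hq, hgq⟩ := hg x hx
  exact ⟨fun x => p x - q x, hp.sub hq, hfp.sub hgq⟩

theorem mul (hf : SmoothUpTo Ω k f) (hg : SmoothUpTo Ω k g) :
    SmoothUpTo Ω k (fun x => f x * g x) := fun x hx => by
  obtain ⟨p, hp, hfp⟩ := hf x hx
  obtain ⟨q, hq, hgq⟩ := hg x hx
  exact ⟨fun x => p x * q x, hp.mul hq, hfp.mul hgq⟩

theorem const (a : ℝ) : SmoothUpTo Ω k (fun _ => a) :=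
  fun _ _ => ⟨fun _ => a, contDiffWithinAt_const, Filter.EventuallyEq.rfl⟩

theorem sum {ι : Type*} (s : Finset ι) {F : ι → (Fin n → ℝ) → ℝ}
    (hF : ∀ i ∈ s, SmoothUpTo Ω k (F i)) : SmoothUpTo Ω k (fun x => ∑ i ∈ s, F i x) := by
  classical
  induction s using Finset.induction_on with
  | empty => simpa using const 0
  | insert a s ha ih =>
    simp only [Finset.sum_insert ha]
    exact (hF a (Finset.mem_insert_self a s)).add
      (ih fun i hi => hF i (Finset.mem_insert_of_mem hi))

theorem comp {φ : ℝ → ℝ} (hφ : ContDiff ℝ k φ) (hf : SmoothUpTo Ω k f) :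
    SmoothUpTo Ω k (fun x => φ (f x)) := fun x hx => by
  obtain ⟨p, hp, hfp⟩ := hf x hx
  exact ⟨fun x => φ (p x), hφ.comp_contDiffWithinAt hp, hfp.fun_comp φ⟩

theorem contDiffOn (hg : SmoothUpTo Ω k g) : ContDiffOn ℝ k g Ω := fun x hx => by
  obtain ⟨h, hh, hgh⟩ := hg x (subset_closure hx)
  exact (hh.mono subset_closure).congr_of_eventuallyEq hgh (hgh.self_of_nhdsWithin hx)

theorem differentiableOn (hg : SmoothUpTo Ω (k + 1) g) : DifferentiableOn ℝ g Ω :=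
  (hg.contDiffOn).differentiableOn (by simp)

theorem differentiableAt (hΩ : IsOpen Ω) (hg : SmoothUpTo Ω (k + 1) g) {x : Fin n → ℝ}
    (hx : x ∈ Ω) : DifferentiableAt ℝ g x :=
  (hg.differentiableOn x hx).differentiableAt (hΩ.mem_nhds hx)

theorem xop (hΩ : IsOpen Ω) {c : (Fin n → ℝ) → (Fin n → ℝ)}
    (hc : ContDiffOn ℝ (⊤ : ℕ∞) c (closure Ω)) (hg : SmoothUpTo Ω (k + 1) g) :
    SmoothUpTo Ω k (Xop c g) := fun x hx => by
  obtain ⟨h, hh, hgh⟩ := hg x hx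
  push_cast at hh
  rw [contDiffWithinAt_succ_iff_hasFDerivWithinAt' (by simp)] at hh
  obtain ⟨u, hu, -, -, h', hh', hsm⟩ := hh
  rw [Set.insert_eq_of_mem hx] at hu
  refine ⟨fun y => h' y (c y), hsm.clm_apply ((hc x hx).of_le (by exact_mod_cast le_top)), ?_⟩
  filter_upwards [eventually_eventually_nhdsWithin.2 hgh, nhdsWithin_mono x subset_closure hu,
    self_mem_nhdsWithin] with y hy hyu hyΩ
  rw [hΩ.nhdsWithin_eq hyΩ] at hy
  have hd : HasFDerivAt h (h' y) y :=
    (hh' y hyu).hasFDerivAt (mem_of_superset (hΩ.mem_nhds hyΩ) subset_closure)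
  rw [Xop, Filter.EventuallyEq.fderiv_eq hy, hd.fderiv]

theorem integrableOn (hΩ : IsOpen Ω) (hb : Bornology.IsBounded Ω) (hg : SmoothUpTo Ω 0 g) :
    IntegrableOn g Ω := by
  have hcont : ContinuousOn g Ω := (hg.contDiffOn).continuousOn
  have key : IntegrableOn g (closure Ω ∩ Ω) := by
    refine hb.isCompact_closure.induction_on (p := fun s => IntegrableOn g (s ∩ Ω) volume)
      (by simp)
      (fun s t hst ht => ht.mono_set (Set.inter_subset_inter_left _ hst))
      (fun s t hs ht => by rw [Set.union_inter_distrib_right]; exact hs.union ht)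
      fun x hx => ?_
    obtain ⟨h, hh, hgh⟩ := hg x hx
    have hbd : ∀ᶠ y in 𝓝[Ω] x, ‖g y‖ ≤ ‖h x‖ + 1 := by
      have h1 : ∀ᶠ y in 𝓝[Ω] x, ‖h y‖ < ‖h x‖ + 1 :=
        ((hh.continuousWithinAt.mono subset_closure).norm).eventually_lt_const (lt_add_one _)
      filter_upwards [hgh, h1] with y hy hy'
      rw [hy]
      exact hy'.le
    obtain ⟨U, hU, hxU, hUs⟩ := mem_nhdsWithin.1 hbd
    refine ⟨U, mem_nhdsWithin_of_mem_nhds (hU.mem_nhds hxU), ?_⟩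
    have hm : MeasurableSet (U ∩ Ω) := (hU.inter hΩ).measurableSet
    refine ⟨(hcont.mono Set.inter_subset_right).aestronglyMeasurable hm,
      .restrict_of_bounded (C := ‖h x‖ + 1)
        ((measure_mono Set.inter_subset_right).trans_lt hb.measure_lt_top)
        ((ae_restrict_iff' hm).2 (ae_of_all _ fun y hy => hUs hy))⟩
  rwa [Set.inter_eq_right.2 subset_closure] at key

end SmoothUpTo

section Integration

variable {n : ℕ} {Ω : Set (Fin n → ℝ)}

theorem integral_fderiv_apply_eq_zero {G : (Fin n → ℝ) → ℝ} (hG : ContDiff ℝ 1 G)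
    (hs : HasCompactSupport G) (e : Fin n → ℝ) : ∫ x, fderiv ℝ G x e = 0 := by
  have hG' : Continuous fun x => fderiv ℝ G x e :=
    (hG.continuous_fderiv (by simp)).clm_apply continuous_const
  have h := integral_mul_fderiv_eq_neg_fderiv_mul_of_integrable (μ := (volume : Measure (Fin n → ℝ)))
    (f := fun _ => (1 : ℝ)) (g := G) (v := e) (by simp)
    (by simpa using hG'.integrable_of_hasCompactSupport (hs.fderiv_apply ℝ e))
    (by simpa using hG.continuous.integrable_of_hasCompactSupport hs)
    (fun x _ => differentiableAt_const _) (fun x _ => (hG.differentiable (by simp)) x)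
  simpa using h

/-- The divergence theorem for divergence-free fields and functions supported in a compact subset
of `Ω`. -/
theorem setIntegral_Xop_eq_zero (hΩ : IsOpen Ω) {K : Set (Fin n → ℝ)} (hK : IsCompact K)
    (hKΩ : K ⊆ Ω) {c : (Fin n → ℝ) → (Fin n → ℝ)} (hc : ContDiffOn ℝ 1 c Ω)
    (hdiv : ∀ x ∈ Ω, ∑ j, fderiv ℝ (fun y => c y j) x (Pi.single j 1) = 0)
    {g : (Fin n → ℝ) → ℝ} (hg : ContDiffOn ℝ 1 g Ω) (hgK : ∀ x ∈ Ω \ K, g x = 0) :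
    ∫ x in Ω, Xop c g x = 0 := by
  classical
  set G : Fin n → (Fin n → ℝ) → ℝ := fun j => Ω.indicator fun x => g x * c x j with hGdef
  have hGK : ∀ j, ∀ x ∉ K, G j x = 0 := fun j x hx => by
    by_cases hxΩ : x ∈ Ω
    · simp [hGdef, hxΩ, hgK x ⟨hxΩ, hx⟩]
    · simp [hGdef, hxΩ]
  have hcj : ∀ j, ContDiffOn ℝ 1 (fun x => c x j) Ω := fun j => contDiffOn_pi.1 hc j
  have hGloc : ∀ j, ∀ x ∈ Ω, G j =ᶠ[𝓝 x] fun x => g x * c x j := fun j x hx => by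
    filter_upwards [hΩ.mem_nhds hx] with y hy
    simp [hGdef, hy]
  have hGsm : ∀ j, ContDiff ℝ 1 (G j) := fun j => contDiff_iff_contDiffAt.2 fun x => by
    by_cases hx : x ∈ Ω
    · exact (((hg.mul (hcj j)).contDiffAt (hΩ.mem_nhds hx))).congr_of_eventuallyEq (hGloc j x hx)
    · have h0 : G j =ᶠ[𝓝 x] fun _ => 0 := by
        filter_upwards [hK.isClosed.isOpen_compl.mem_nhds (fun h => hx (hKΩ h))] with y hy
        exact hGK j y hy
      exact contDiffAt_const.congr_of_eventuallyEq h0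
  have hGcs : ∀ j, HasCompactSupport (G j) := fun j => HasCompactSupport.intro hK (hGK j)
  have hin : ∀ x ∈ Ω, Xop c g x = ∑ j, fderiv ℝ (G j) x (Pi.single j 1) := fun x hx => by
    have hgd := (hg.differentiableOn (by simp) x hx).differentiableAt (hΩ.mem_nhds hx)
    have hcd : ∀ j, DifferentiableAt ℝ (fun x => c x j) x := fun j =>
      ((hcj j).differentiableOn (by simp) x hx).differentiableAt (hΩ.mem_nhds hx)
    have h1 : ∀ j, fderiv ℝ (G j) x (Pi.single j 1) =
        g x * fderiv ℝ (fun y => c y j) x (Pi.single j 1)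
          + c x j * fderiv ℝ g x (Pi.single j 1) := fun j => by
      rw [(hGloc j x hx).fderiv_eq, fderiv_fun_mul hgd (hcd j)]
      simp
    simp only [h1, Finset.sum_add_distrib, ← Finset.mul_sum, hdiv x hx, mul_zero, zero_add]
    have h2 : c x = ∑ j, c x j • (Pi.single j 1 : Fin n → ℝ) := pi_eq_sum_univ' (c x)
    rw [Xop]
    conv_lhs => rw [h2, map_sum]
    simp
  have hout : ∀ x ∉ Ω, ∑ j, fderiv ℝ (G j) x (Pi.single j 1) = 0 := fun x hx => by
    refine Finset.sum_eq_zero fun j _ => ?_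
    have h0 : G j =ᶠ[𝓝 x] fun _ => 0 := by
      filter_upwards [hK.isClosed.isOpen_compl.mem_nhds (fun h => hx (hKΩ h))] with y hy
      exact hGK j y hy
    rw [h0.fderiv_eq]
    simp
  rw [setIntegral_congr_fun hΩ.measurableSet hin,
    setIntegral_eq_integral_of_forall_compl_eq_zero hout,
    integral_finsetSum _ fun j _ => (((hGsm j).continuous_fderiv (by simp)).clm_apply
      continuous_const).integrable_of_hasCompactSupport ((hGcs j).fderiv_apply ℝ _)]
  exact Finset.sum_eq_zero fun j _ => integral_fderiv_apply_eq_zero (hGsm j) (hGcs j) _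

/-- The derivative of a differentiable function vanishes almost everywhere on its zero set. -/
theorem ae_fderiv_eq_zero_of_eq_zero (hΩ : IsOpen Ω) {g : (Fin n → ℝ) → ℝ}
    (hg : DifferentiableOn ℝ g Ω) :
    ∀ᵐ x ∂(volume.restrict Ω), g x = 0 → fderiv ℝ g x = 0 := by
  set s : Set (Fin n → ℝ) := Ω ∩ g ⁻¹' {0} with hs
  have hsm : MeasurableSet s := by
    obtain ⟨t, ht, hst⟩ := (continuousOn_iff_isClosed.1 hg.continuousOn) {0} isClosed_singleton
    rw [hs, Set.inter_comm, hst]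
    exact ht.measurableSet.inter hΩ.measurableSet
  set L : ℝ →L[ℝ] (Fin n → ℝ) := ContinuousLinearMap.pi fun _ => ContinuousLinearMap.id ℝ ℝ with hL
  have happ : ApproximatesLinearOn (fun x => L (g x)) (0 : (Fin n → ℝ) →L[ℝ] (Fin n → ℝ)) s 0 := by
    intro x hx y hy
    have h1 : g x = 0 := hx.2
    have h2 : g y = 0 := hy.2
    simp [h1, h2]
  have key := happ.norm_fderiv_sub_le volume hsm (fun x => L.comp (fderiv ℝ g x)) fun x hx =>
    (L.hasFDerivAt.comp x
      ((hg x hx.1).differentiableAt (hΩ.mem_nhds hx.1)).hasFDerivAt).hasFDerivWithinAt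
  rw [ae_restrict_iff' hsm] at key
  rw [ae_restrict_iff' hΩ.measurableSet]
  filter_upwards [key] with x hx hxΩ hgx
  have h0 : L.comp (fderiv ℝ g x) = 0 := by
    have := hx ⟨hxΩ, hgx⟩
    simpa using this
  refine ContinuousLinearMap.ext fun y => ?_
  rcases isEmpty_or_nonempty (Fin n) with _ | ⟨⟨i⟩⟩
  · simp [Subsingleton.elim y 0]
  · simpa [hL] using
      congrFun (congrArg (fun T : (Fin n → ℝ) →L[ℝ] (Fin n → ℝ) => T y) h0) i

theorem ae_Xop_eq_zero_of_eq_zero (hΩ : IsOpen Ω) {g : (Fin n → ℝ) → ℝ}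
    (hg : DifferentiableOn ℝ g Ω) (c : (Fin n → ℝ) → (Fin n → ℝ)) :
    ∀ᵐ x ∂(volume.restrict Ω), g x = 0 → Xop c g x = 0 := by
  filter_upwards [ae_fderiv_eq_zero_of_eq_zero hΩ hg] with x hx h0
  simp [Xop, hx h0]

end Integration

/-- A smooth convex function which vanishes on `(-∞, ε]` and has slope one on `[2ε, ∞)`. -/
theorem exists_convex_cutoff {ε : ℝ} (hε : 0 < ε) : ∃ φ : ℝ → ℝ, ContDiff ℝ (⊤ : ℕ∞) φ ∧
    (∀ t ≤ ε, φ t = 0) ∧ (∀ t, 0 ≤ deriv φ t) ∧ (∀ t, deriv φ t ≤ 1) ∧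
    (∀ t ≤ ε, deriv φ t = 0) ∧ (∀ t, 2 * ε ≤ t → deriv φ t = 1) ∧
    ∀ t, 0 ≤ deriv (deriv φ) t := by
  set ψ : ℝ → ℝ := fun t => Real.smoothTransition (t / ε - 1) with hψ
  have hψc : ContDiff ℝ (⊤ : ℕ∞) ψ :=
    Real.smoothTransition.contDiff.comp ((contDiff_id.div_const ε).sub contDiff_const)
  have hψ0 : ∀ t ≤ ε, ψ t = 0 := fun t ht =>
    Real.smoothTransition.zero_of_nonpos (by rw [sub_nonpos, div_le_one hε]; exact ht)
  have hd : ∀ t, HasDerivAt (fun t => ∫ s in (0 : ℝ)..t, ψ s) (ψ t) t := fun t =>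
    (hψc.continuous.integral_hasStrictDerivAt 0 t).hasDerivAt
  have hderiv : deriv (fun t => ∫ s in (0 : ℝ)..t, ψ s) = ψ := funext fun t => (hd t).deriv
  have hmono : Monotone ψ := fun s t hst =>
    Real.smoothTransition.monotone (by gcongr)
  refine ⟨fun t => ∫ s in (0 : ℝ)..t, ψ s, ?_, ?_, ?_⟩
  · rw [contDiff_infty_iff_deriv]
    exact ⟨fun t => (hd t).differentiableAt, by rwa [hderiv]⟩
  · intro t ht
    refine (intervalIntegral.integral_congr (g := fun _ => 0) fun s hs => ?_).trans (by simp)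
    exact hψ0 s ((Set.mem_uIcc.1 hs).elim (fun h => h.2.trans ht) fun h => h.2.trans hε.le)
  · rw [hderiv]
    refine ⟨fun t => Real.smoothTransition.nonneg _, fun t => Real.smoothTransition.le_one _, hψ0,
      fun t ht => Real.smoothTransition.one_of_one_le ?_, fun t => hmono.deriv_nonneg⟩
    rw [le_sub_iff_add_le, le_div_iff₀ hε]
    linarith

section QuadraticForm

variable {n m : ℕ} {Ω : Set (Fin n → ℝ)} {b : Fin m → (Fin n → ℝ) → (Fin n → ℝ)}
  {u v w s : (Fin n → ℝ) → ℝ}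

theorem calF2bil_sub_add (hΩ : IsOpen Ω) (hb : ∀ i, ContDiffOn ℝ (⊤ : ℕ∞) (b i) (closure Ω))
    (hu : SmoothUpTo Ω 3 u) (hv : SmoothUpTo Ω 3 v) :
    ∀ x ∈ Ω, calF2bil b (fun y => v y - u y) (fun y => u y + v y) x
      = calF2bil b v v x - calF2bil b u u x := by
  have lin : ∀ {α β : ℝ} {h : (Fin n → ℝ) → ℝ}, (∀ x ∈ Ω, h x = α * u x + β * v x) →
      (∀ i, ∀ x ∈ Ω, Xop (b i) h x = α * Xop (b i) u x + β * Xop (b i) v x) ∧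
      (∀ i j, ∀ x ∈ Ω, Xop (b i) (Xop (b j) h) x
        = α * Xop (b i) (Xop (b j) u) x + β * Xop (b i) (Xop (b j) v) x) ∧
      (∀ i j k, ∀ x ∈ Ω, Xop (b i) (Xop (b j) (Xop (b k) h)) x
        = α * Xop (b i) (Xop (b j) (Xop (b k) u)) x
          + β * Xop (b i) (Xop (b j) (Xop (b k) v)) x) := by
    intro α β h hh
    have h1 : ∀ i, ∀ x ∈ Ω, Xop (b i) h x = α * Xop (b i) u x + β * Xop (b i) v x := fun i =>
      Xop_linear hΩ hu.differentiableOn hv.differentiableOn hh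
    have h2 : ∀ i j, ∀ x ∈ Ω, Xop (b i) (Xop (b j) h) x
        = α * Xop (b i) (Xop (b j) u) x + β * Xop (b i) (Xop (b j) v) x := fun i j =>
      Xop_linear hΩ (hu.xop hΩ (hb j)).differentiableOn (hv.xop hΩ (hb j)).differentiableOn (h1 j)
    exact ⟨h1, h2, fun i j k => Xop_linear hΩ
      ((hu.xop hΩ (hb k)).xop hΩ (hb j)).differentiableOn
      ((hv.xop hΩ (hb k)).xop hΩ (hb j)).differentiableOn (h2 j k)⟩
  obtain ⟨w1, w2, w3⟩ := lin (α := -1) (β := 1) (h := fun y => v y - u y) fun x _ => by ring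
  obtain ⟨s1, s2, s3⟩ := lin (α := 1) (β := 1) (h := fun y => u y + v y) fun x _ => by ring
  intro x hx
  simp only [calF2bil, ← Finset.sum_sub_distrib]
  refine Finset.sum_congr rfl fun i _ => Finset.sum_congr rfl fun j _ => ?_
  simp only [w1 _ x hx, w2 _ _ x hx, w3 _ _ _ x hx, s1 _ x hx, s2 _ _ x hx, s3 _ _ _ x hx]
  ring

/-- The form `calF2bil` differentiates a composition `φ ∘ w` like a second-order operator. -/
theorem calF2bil_comp (hΩ : IsOpen Ω) (hb : ∀ i, ContDiffOn ℝ (⊤ : ℕ∞) (b i) (closure Ω))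
    (hw : SmoothUpTo Ω 3 w) {φ : ℝ → ℝ} (hφ : ContDiff ℝ (⊤ : ℕ∞) φ) :
    ∀ x ∈ Ω, calF2bil b (fun y => φ (w y)) s x = deriv φ (w x) * calF2bil b w s x
      + deriv (deriv φ) (w x) * ∑ i, ∑ j,
        ((1 / 4) * (Xop (b i) w x ^ 2 * Xop (b j) (Xop (b j) s) x
            + Xop (b j) w x ^ 2 * Xop (b i) (Xop (b i) s) x)
          - (1 / 2) * (Xop (b i) w x * Xop (b j) w x * Xop (b j) (Xop (b i) s) x)) := by
  have hφ1 : ContDiff ℝ (⊤ : ℕ∞) (deriv φ) := (contDiff_infty_iff_deriv.1 hφ).2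
  have hφ2 : ContDiff ℝ (⊤ : ℕ∞) (deriv (deriv φ)) := (contDiff_infty_iff_deriv.1 hφ1).2
  have dφ0 : Differentiable ℝ φ := hφ.differentiable (by simp)
  have dφ1 : Differentiable ℝ (deriv φ) := hφ1.differentiable (by simp)
  have dφ2 : Differentiable ℝ (deriv (deriv φ)) := hφ2.differentiable (by simp)
  have dw : ∀ x ∈ Ω, DifferentiableAt ℝ w x := fun x hx => hw.differentiableAt hΩ hx
  have dw1 : ∀ i, ∀ x ∈ Ω, DifferentiableAt ℝ (Xop (b i) w) x := fun i x hx =>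
    (hw.xop hΩ (hb i)).differentiableAt hΩ hx
  have dw2 : ∀ i j, ∀ x ∈ Ω, DifferentiableAt ℝ (Xop (b i) (Xop (b j) w)) x := fun i j x hx =>
    ((hw.xop hΩ (hb j)).xop hΩ (hb i)).differentiableAt hΩ hx
  have dc : ∀ {ψ : ℝ → ℝ}, Differentiable ℝ ψ → ∀ x ∈ Ω, DifferentiableAt ℝ (fun y => ψ (w y)) x :=
    fun hψ x hx => (hψ (w x)).comp x (dw x hx)
  have e1 : ∀ i, ∀ x ∈ Ω, Xop (b i) (fun y => φ (w y)) x = deriv φ (w x) * Xop (b i) w x :=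
    fun i x hx => Xop_comp (dφ0 _) (dw x hx)
  have e2 : ∀ i j, ∀ x ∈ Ω, Xop (b i) (Xop (b j) (fun y => φ (w y))) x
      = deriv (deriv φ) (w x) * (Xop (b i) w x * Xop (b j) w x)
        + deriv φ (w x) * Xop (b i) (Xop (b j) w) x := fun i j x hx => by
    rw [Xop_congr hΩ (e1 j) x hx, Xop_mul (dc dφ1 x hx) (dw1 j x hx), Xop_comp (dφ1 _) (dw x hx)]
    ring
  have e3 : ∀ k i j, ∀ x ∈ Ω, Xop (b k) (Xop (b i) (Xop (b j) (fun y => φ (w y)))) x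
      = deriv (deriv (deriv φ)) (w x) * (Xop (b k) w x * Xop (b i) w x * Xop (b j) w x)
        + deriv (deriv φ) (w x) * (Xop (b k) (Xop (b i) w) x * Xop (b j) w x
          + Xop (b i) w x * Xop (b k) (Xop (b j) w) x
          + Xop (b k) w x * Xop (b i) (Xop (b j) w) x)
        + deriv φ (w x) * Xop (b k) (Xop (b i) (Xop (b j) w)) x := fun k i j x hx => by
    rw [Xop_congr hΩ (e2 i j) x hx,
      Xop_add ((dc dφ2 x hx).fun_mul ((dw1 i x hx).fun_mul (dw1 j x hx)))
        ((dc dφ1 x hx).fun_mul (dw2 i j x hx)),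
      Xop_mul (dc dφ2 x hx) ((dw1 i x hx).fun_mul (dw1 j x hx)),
      Xop_mul (dw1 i x hx) (dw1 j x hx), Xop_mul (dc dφ1 x hx) (dw2 i j x hx),
      Xop_comp (dφ1 _) (dw x hx), Xop_comp (dφ2 _) (dw x hx)]
    ring
  intro x hx
  simp only [calF2bil, Finset.mul_sum, ← Finset.sum_add_distrib]
  refine Finset.sum_congr rfl fun i _ => Finset.sum_congr rfl fun j _ => ?_
  simp only [e1 _ x hx, e2 _ _ x hx, e3 _ _ _ x hx]
  ring

theorem SmoothUpTo.calF2bil (hΩ : IsOpen Ω)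
    (hb : ∀ i, ContDiffOn ℝ (⊤ : ℕ∞) (b i) (closure Ω)) (hw : SmoothUpTo Ω 3 w)
    (hs : SmoothUpTo Ω 3 s) : SmoothUpTo Ω 0 (calF2bil b w s) := by
  have f1 : ∀ {g}, SmoothUpTo Ω 3 g → ∀ i, SmoothUpTo Ω 0 (Xop (b i) g) := fun hg i =>
    (hg.xop hΩ (hb i)).of_le (by norm_num)
  have f2 : ∀ {g}, SmoothUpTo Ω 3 g → ∀ i j, SmoothUpTo Ω 0 (Xop (b i) (Xop (b j) g)) :=
    fun hg i j => ((hg.xop hΩ (hb j)).xop hΩ (hb i)).of_le (by norm_num)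
  have f3 : ∀ {g}, SmoothUpTo Ω 3 g → ∀ i j k,
      SmoothUpTo Ω 0 (Xop (b i) (Xop (b j) (Xop (b k) g))) :=
    fun hg i j k => ((hg.xop hΩ (hb k)).xop hΩ (hb j)).xop hΩ (hb i)
  refine SmoothUpTo.sum _ fun i _ => SmoothUpTo.sum _ fun j _ => ?_
  exact (((((const _).mul (((f2 hw i i).mul (f2 hs j j)).add ((f2 hw j j).mul (f2 hs i i)))).add
    ((const _).mul ((f2 hw i j).mul (f2 hs i j)))).sub
    ((const _).mul (((f2 hw i j).mul (f2 hs j i)).add ((f2 hw j i).mul (f2 hs i j))))).add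
    ((const _).mul ((f1 hw j).mul
      (((f3 hs i i j).sub ((const _).mul (f3 hs i j i))).add (f3 hs j i i))))).add
    ((const _).mul ((f1 hs j).mul
      (((f3 hw i i j).sub ((const _).mul (f3 hw i j i))).add (f3 hw j i i))))

/-- `calF2bil` is a null Lagrangian: its integral vanishes when the first argument has compact
support in `Ω`. -/
theorem setIntegral_calF2bil_eq_zero (hΩ : IsOpen Ω) (hΩb : Bornology.IsBounded Ω)
    (hb : ∀ i, ContDiffOn ℝ (⊤ : ℕ∞) (b i) (closure Ω)) (hdiv : DivFree Ω b)
    (hw : SmoothUpTo Ω 3 w) (hs : SmoothUpTo Ω 3 s) {K : Set (Fin n → ℝ)} (hK : IsCompact K)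
    (hKΩ : K ⊆ Ω) (hwK : ∀ x ∈ Ω \ K, w x = 0) : ∫ x in Ω, calF2bil b w s x = 0 := by
  have hO : IsOpen (Ω \ K) := hΩ.sdiff hK.isClosed
  have z1 : ∀ i, ∀ x ∈ Ω \ K, Xop (b i) w x = 0 := fun i => Xop_eq_zero_of_eqOn_zero hO hwK
  have z2 : ∀ i j, ∀ x ∈ Ω \ K, Xop (b i) (Xop (b j) w) x = 0 := fun i j =>
    Xop_eq_zero_of_eqOn_zero hO (z1 j)
  have f1 : ∀ {g}, SmoothUpTo Ω 3 g → ∀ i, SmoothUpTo Ω 1 (Xop (b i) g) := fun hg i =>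
    (hg.xop hΩ (hb i)).of_le (by norm_num)
  have f2 : ∀ {g}, SmoothUpTo Ω 3 g → ∀ i j, SmoothUpTo Ω 1 (Xop (b i) (Xop (b j) g)) :=
    fun hg i j => (hg.xop hΩ (hb j)).xop hΩ (hb i)
  -- the potential `X_j w · X_k X_l s + X_j s · X_k X_l w`
  set P : Fin m → Fin m → Fin m → (Fin n → ℝ) → ℝ := fun j k l x =>
    Xop (b j) w x * Xop (b k) (Xop (b l) s) x + Xop (b j) s x * Xop (b k) (Xop (b l) w) x with hP
  have P1 : ∀ j k l, SmoothUpTo Ω 1 (P j k l) := fun j k l =>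
    ((f1 hw j).mul (f2 hs k l)).add ((f1 hs j).mul (f2 hw k l))
  have P0 : ∀ i j k l, ∫ x in Ω, Xop (b i) (P j k l) x = 0 := fun i j k l =>
    setIntegral_Xop_eq_zero hΩ hK hKΩ (((hb i).mono subset_closure).of_le (by exact_mod_cast le_top))
      (hdiv i) (by exact_mod_cast (P1 j k l).contDiffOn)
      fun x hx => by simp [hP, z1 j x hx, z2 k l x hx]
  have PI : ∀ i j k l, IntegrableOn (Xop (b i) (P j k l)) Ω := fun i j k l =>
    ((P1 j k l).xop hΩ (hb i)).integrableOn hΩ hΩb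
  have PX : ∀ i j k l, ∀ x ∈ Ω, Xop (b i) (P j k l) x
      = Xop (b i) (Xop (b j) w) x * Xop (b k) (Xop (b l) s) x
        + Xop (b j) w x * Xop (b i) (Xop (b k) (Xop (b l) s)) x
        + (Xop (b i) (Xop (b j) s) x * Xop (b k) (Xop (b l) w) x
        + Xop (b j) s x * Xop (b i) (Xop (b k) (Xop (b l) w)) x) := fun i j k l x hx => by
    have w1 := (f1 hw j).differentiableAt hΩ hx
    have s1 := (f1 hs j).differentiableAt hΩ hx
    have w2 := (f2 hw k l).differentiableAt hΩ hx
    have s2 := (f2 hs k l).differentiableAt hΩ hx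
    simp only [hP]
    rw [Xop_add (w1.fun_mul s2) (s1.fun_mul w2), Xop_mul w1 s2, Xop_mul s1 w2]
  have hsum : ∀ x ∈ Ω, calF2bil b w s x = ∑ i, ∑ j,
      ((1 / 4) * Xop (b i) (P j i j) x + (1 / 4) * Xop (b j) (P j i i) x
        - (1 / 2) * Xop (b i) (P j j i) x) := fun x hx => by
    rw [calF2bil]
    refine Finset.sum_congr rfl fun i _ => Finset.sum_congr rfl fun j _ => ?_
    simp only [PX _ _ _ _ x hx]
    ring
  have I1 : ∀ i j, IntegrableOn (fun x => (1 / 4) * Xop (b i) (P j i j) x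
      + (1 / 4) * Xop (b j) (P j i i) x) Ω := fun i j =>
    ((PI i j i j).const_mul _).add ((PI j j i i).const_mul _)
  have I2 : ∀ i j, IntegrableOn (fun x => (1 / 2) * Xop (b i) (P j j i) x) Ω := fun i j =>
    (PI i j j i).const_mul _
  have I3 : ∀ i j, IntegrableOn (fun x => (1 / 4) * Xop (b i) (P j i j) x
      + (1 / 4) * Xop (b j) (P j i i) x - (1 / 2) * Xop (b i) (P j j i) x) Ω := fun i j =>
    (I1 i j).sub (I2 i j)
  rw [setIntegral_congr_fun hΩ.measurableSet hsum, integral_finsetSum _ fun i _ =>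
    integrable_finsetSum _ fun j _ => I3 i j]
  refine Finset.sum_eq_zero fun i _ => ?_
  rw [integral_finsetSum _ fun j _ => I3 i j]
  refine Finset.sum_eq_zero fun j _ => ?_
  rw [integral_sub (I1 i j) (I2 i j),
    integral_add ((PI i j i j).const_mul _) ((PI j j i i).const_mul _)]
  simp only [integral_const_mul, P0]
  simp

theorem ellipticity_sum_nonneg {x : Fin n → ℝ}
    (h : (Matrix.diagonal (fun _ : Fin m => subLap b s x) - symmHess b s x).PosSemidef)
    (a : Fin m → ℝ) :
    0 ≤ ∑ i, ∑ j, ((1 / 4) * (a i ^ 2 * Xop (b j) (Xop (b j) s) x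
            + a j ^ 2 * Xop (b i) (Xop (b i) s) x)
          - (1 / 2) * (a i * a j * Xop (b j) (Xop (b i) s) x)) := by
  have h0 := h.dotProduct_mulVec_nonneg a
  have e1 : star a ⬝ᵥ (Matrix.diagonal (fun _ : Fin m => subLap b s x) - symmHess b s x).mulVec a
      = (∑ i, ∑ j, a i ^ 2 * Xop (b j) (Xop (b j) s) x)
        - ∑ i, ∑ j, a i * a j * symmHess b s x i j := by
    rw [Matrix.sub_mulVec, dotProduct_sub]
    congr 1
    · simp only [dotProduct, Matrix.mulVec_diagonal, subLap, Pi.star_apply, star_trivial,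
        Finset.mul_sum, Finset.sum_mul]
      exact Finset.sum_congr rfl fun i _ => Finset.sum_congr rfl fun j _ => by ring
    · simp only [dotProduct, Matrix.mulVec, Pi.star_apply, star_trivial, Finset.mul_sum]
      exact Finset.sum_congr rfl fun i _ => Finset.sum_congr rfl fun j _ => by ring
  have e2 : ∑ i, ∑ j, a j ^ 2 * Xop (b i) (Xop (b i) s) x
      = ∑ i, ∑ j, a i ^ 2 * Xop (b j) (Xop (b j) s) x := Finset.sum_comm
  have e3 : ∑ i, ∑ j, a i * a j * Xop (b i) (Xop (b j) s) x
      = ∑ i, ∑ j, a i * a j * Xop (b j) (Xop (b i) s) x := by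
    rw [Finset.sum_comm]
    exact Finset.sum_congr rfl fun i _ => Finset.sum_congr rfl fun j _ => by ring
  have e4 : ∑ i, ∑ j, a i * a j * symmHess b s x i j
      = ∑ i, ∑ j, a i * a j * Xop (b j) (Xop (b i) s) x := by
    have : ∀ i j, a i * a j * symmHess b s x i j
        = (1 / 2) * (a i * a j * Xop (b i) (Xop (b j) s) x)
          + (1 / 2) * (a i * a j * Xop (b j) (Xop (b i) s) x) := fun i j => by
      simp only [symmHess]; ring
    simp only [this, Finset.sum_add_distrib, ← Finset.mul_sum, e3]
    ring
  rw [e1, e4] at h0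
  have e5 : ∑ i, ∑ j, ((1 / 4) * (a i ^ 2 * Xop (b j) (Xop (b j) s) x
            + a j ^ 2 * Xop (b i) (Xop (b i) s) x)
          - (1 / 2) * (a i * a j * Xop (b j) (Xop (b i) s) x))
      = (1 / 4) * ((∑ i, ∑ j, a i ^ 2 * Xop (b j) (Xop (b j) s) x)
          + ∑ i, ∑ j, a j ^ 2 * Xop (b i) (Xop (b i) s) x)
        - (1 / 2) * ∑ i, ∑ j, a i * a j * Xop (b j) (Xop (b i) s) x := by
    simp only [Finset.mul_sum, ← Finset.sum_add_distrib, ← Finset.sum_sub_distrib]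
  rw [e5, e2]
  linarith

theorem ae_calF2bil_eq_zero_of_eq_zero (hΩ : IsOpen Ω)
    (hb : ∀ i, ContDiffOn ℝ (⊤ : ℕ∞) (b i) (closure Ω)) (hw : SmoothUpTo Ω 3 w) :
    ∀ᵐ x ∂(volume.restrict Ω), w x = 0 → calF2bil b w s x = 0 := by
  have h1 : ∀ᵐ x ∂(volume.restrict Ω), ∀ i, w x = 0 → Xop (b i) w x = 0 :=
    ae_all_iff.2 fun i => ae_Xop_eq_zero_of_eq_zero hΩ hw.differentiableOn _
  have h2 : ∀ᵐ x ∂(volume.restrict Ω), ∀ i j, Xop (b j) w x = 0 → Xop (b i) (Xop (b j) w) x = 0 :=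
    ae_all_iff.2 fun i => ae_all_iff.2 fun j =>
      ae_Xop_eq_zero_of_eq_zero hΩ (hw.xop hΩ (hb j)).differentiableOn _
  have h3 : ∀ᵐ x ∂(volume.restrict Ω), ∀ i j k, Xop (b j) (Xop (b k) w) x = 0 →
      Xop (b i) (Xop (b j) (Xop (b k) w)) x = 0 :=
    ae_all_iff.2 fun i => ae_all_iff.2 fun j => ae_all_iff.2 fun k =>
      ae_Xop_eq_zero_of_eq_zero hΩ ((hw.xop hΩ (hb k)).xop hΩ (hb j)).differentiableOn _
  filter_upwards [h1, h2, h3] with x h1 h2 h3 hx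
  have z1 := fun i => h1 i hx
  have z2 := fun i j => h2 i j (z1 j)
  have z3 := fun i j k => h3 i j k (z2 j k)
  simp [calF2bil, z1, z2, z3]

theorem setIntegral_calF2bil_nonpos (hΩ : IsOpen Ω) (hΩb : Bornology.IsBounded Ω)
    (hb : ∀ i, ContDiffOn ℝ (⊤ : ℕ∞) (b i) (closure Ω)) (hdiv : DivFree Ω b)
    (hw : SmoothUpTo Ω 3 w) (hs : SmoothUpTo Ω 3 s) (hwc : ContinuousOn w (closure Ω))
    (hw0 : ∀ x ∈ Ω, 0 ≤ w x) (hwf : ∀ x ∈ frontier Ω, w x = 0)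
    (hell : ∀ x ∈ Ω,
      (Matrix.diagonal (fun _ : Fin m => subLap b s x) - symmHess b s x).PosSemidef) :
    ∫ x in Ω, calF2bil b w s x ≤ 0 := by
  have hε : ∀ k : ℕ, (0 : ℝ) < 1 / ((k : ℝ) + 1) := fun k => Nat.one_div_pos_of_nat
  choose φ hφ hφ0 hφnn hφle hφ' hφone hφcv using fun k => exists_convex_cutoff (hε k)
  have hQ : IntegrableOn (calF2bil b w s) Ω := (hw.calF2bil hΩ hb hs).integrableOn hΩ hΩb
  have hcut : ∀ k, SmoothUpTo Ω 3 fun x => φ k (w x) := fun k =>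
    SmoothUpTo.comp (contDiff_infty.1 (hφ k) 3) hw
  have hmeas : ∀ k, AEStronglyMeasurable (fun x => deriv (φ k) (w x) * calF2bil b w s x)
      (volume.restrict Ω) := fun k =>
    ((((hφ k).continuous_deriv (by simp)).comp_continuousOn
      (hwc.mono subset_closure)).aestronglyMeasurable hΩ.measurableSet).mul hQ.1
  have hbound : ∀ k, ∀ᵐ x ∂(volume.restrict Ω),
      ‖deriv (φ k) (w x) * calF2bil b w s x‖ ≤ ‖calF2bil b w s x‖ := fun k =>
    ae_of_all _ fun x => by
      rw [norm_mul, Real.norm_of_nonneg (hφnn k _)]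
      exact mul_le_of_le_one_left (norm_nonneg _) (hφle k _)
  have hle : ∀ k, ∫ x in Ω, deriv (φ k) (w x) * calF2bil b w s x ≤ 0 := fun k => by
    have hK : IsCompact (closure Ω ∩ w ⁻¹' Set.Ici (1 / ((k : ℝ) + 1))) :=
      hΩb.isCompact_closure.of_isClosed_subset
        (hwc.preimage_isClosed_of_isClosed isClosed_closure isClosed_Ici) Set.inter_subset_left
    have hKΩ : closure Ω ∩ w ⁻¹' Set.Ici (1 / ((k : ℝ) + 1)) ⊆ Ω := fun x hx => by
      by_contra hxΩ
      have h0 := hwf x ⟨hx.1, by rwa [hΩ.interior_eq]⟩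
      have h1 : 1 / ((k : ℝ) + 1) ≤ w x := hx.2
      linarith [hε k]
    rw [← setIntegral_calF2bil_eq_zero hΩ hΩb hb hdiv (hcut k) hs hK hKΩ fun x hx =>
      hφ0 k _ (le_of_not_ge fun h => hx.2 ⟨subset_closure hx.1, h⟩)]
    refine setIntegral_mono_on (Integrable.mono hQ (hmeas k) (hbound k))
      (((hcut k).calF2bil hΩ hb hs).integrableOn hΩ hΩb) hΩ.measurableSet fun x hx => ?_
    rw [calF2bil_comp hΩ hb hw (hφ k) x hx]
    exact le_add_of_nonneg_right
      (mul_nonneg (hφcv k _) (ellipticity_sum_nonneg (hell x hx) fun i => Xop (b i) w x))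
  refine le_of_tendsto (tendsto_integral_of_dominated_convergence _ hmeas hQ.norm hbound ?_)
    (Eventually.of_forall hle)
  filter_upwards [ae_calF2bil_eq_zero_of_eq_zero (s := s) hΩ hb hw,
    ae_restrict_mem hΩ.measurableSet] with x hx0 hx
  rcases (hw0 x hx).eq_or_lt with h0 | hpos
  · simp [hx0 h0.symm]
  · have h2 : Tendsto (fun k : ℕ => 2 * (1 / ((k : ℝ) + 1))) atTop (𝓝 0) := by
      simpa using (tendsto_one_div_add_atTop_nhds_zero_nat (𝕜 := ℝ)).const_mul 2
    refine tendsto_const_nhds.congr' ?_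
    filter_upwards [h2.eventually_le_const hpos] with k hk
    rw [hφone k _ hk, one_mul]

end QuadraticForm

/-- monotonicity without condition (iii). Under condition (i) only,
if `u ≤ v` in `Ω`, `u = v` on `∂Ω` and `F₂` is degenerate elliptic with respect to
`u + v`, then `∫_Ω 𝓕₂*[v] ≤ ∫_Ω 𝓕₂*[u]`. -/
theorem monotonicity_calF2star (n m : ℕ) (Ω : Set (Fin n → ℝ))
    (hΩo : IsOpen Ω) (hΩb : Bornology.IsBounded Ω) (hΩc : HasC1Boundary Ω)
    (b : Fin m → (Fin n → ℝ) → (Fin n → ℝ))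
    (hb : ∀ i, ContDiffOn ℝ (⊤ : ℕ∞) (b i) (closure Ω))
    (hcond1 : DivFree Ω b)
    (u v : (Fin n → ℝ) → ℝ)
    (hu : ContDiffOn ℝ 3 u (closure Ω)) (hv : ContDiffOn ℝ 3 v (closure Ω))
    (huv : ∀ x ∈ Ω, u x ≤ v x) (hbd : ∀ x ∈ frontier Ω, u x = v x)
    (hell : ∀ x ∈ Ω,
      (Matrix.diagonal (fun _ : Fin m => subLap b (fun y => u y + v y) x) -
        symmHess b (fun y => u y + v y) x).PosSemidef) :
    ∫ x in Ω, calF2star b v x ≤ ∫ x in Ω, calF2star b u x := by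
  have hu' : SmoothUpTo Ω 3 u := .of_contDiffOn hu (by norm_num)
  have hv' : SmoothUpTo Ω 3 v := .of_contDiffOn hv (by norm_num)
  have h := setIntegral_calF2bil_nonpos hΩo hΩb hb hcond1 (hv'.sub hu') (hu'.add hv')
    (hv.continuousOn.sub hu.continuousOn) (fun x hx => sub_nonneg.2 (huv x hx))
    (fun x hx => sub_eq_zero.2 (hbd x hx).symm) hell
  rw [setIntegral_congr_fun hΩo.measurableSet (calF2bil_sub_add hΩo hb hu' hv'),
    integral_sub ((hv'.calF2bil hΩo hb hv').integrableOn hΩo hΩb)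
      ((hu'.calF2bil hΩo hb hu').integrableOn hΩo hΩb)] at h
  simp only [calF2star_eq_calF2bil]
  exact sub_nonpos.1 h
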